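/- Generalized soft-covering lemma: Fix a pmf p(f₁,…,f_r, v, x) on finite sets 𝓕₁×···×𝓕_r×𝒱×𝒳 and positive reals R'₁,…,R'_r such that Σ_{i=1}^s R'_i > I(V; F₁,…,F_s | X) for every 1 ≤ s ≤ r. For each n and each x_{1:n} ∈ 𝒳ⁿ construct a random codebook 𝒞(x_{1:n}) as follows: draw sequences F_{1,1:n}(t₁), for t₁ = 1,…,2^{nR'₁}, independently, each with distribution Π_{k=1}^n p(f₁ | x_k); for each t₁ draw F_{2,1:n}(t₁,t₂), for t₂ = 1,…,2^{nR'₂}, independently, each with distribution Π_{k=1}^n p(f₂ | F_{1,k}(t₁), x_k); continue in this superposition fashion through level r, obtaining F_{r,1:n}(t₁,…,t_r). For a fixed codebook define Q(v_{1:n} | x_{1:n}) = 2^{-n(R'₁+···+R'_r)} Σ_{t₁=1}^{2^{nR'₁}} ··· Σ_{t_r=1}^{2^{nR'_r}} Π_{k=1}^n p(v_k | F_{1,k}(t₁), F_{2,k}(t₁,t₂), …, F_{r,k}(t₁,…,t_r), x_k). Then lim_{n→∞} E‖Q(v_{1:n} | x_{1:n})·Π_{k=1}^n p_X(x_k) −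 Π_{k=1}^n p_{V,X}(v_k, x_k)‖₁ = 0, where the expectation is over the random codebooks 𝒞(x_{1:n}) and ‖·‖₁ is the ℓ¹ distance between the two pmfs on 𝒱ⁿ×𝒳ⁿ. -/

import Mathlib

open scoped BigOperators
open Finset

noncomputable section

namespace Coord

variable {Ω α β γ : Type*}

/-- `p` is a probability mass function on the finite type `α`. -/
def IsPMF [Fintype α] (p : α → ℝ) : Prop := (∀ a, 0 ≤ p a) ∧ ∑ a, p a = 1

/-- ℓ¹ (total variation) distance between two functions on a finite type. -/
def l1dist [Fintype α] (p q : α → ℝ) : ℝ := ∑ a, |p a - q a|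

/-- The distribution (pushforward pmf) of the random variable `X` defined on the
finite sample space `Ω` carrying the pmf `μ`. -/
def distr [Fintype Ω] [DecidableEq α] (μ : Ω → ℝ) (X : Ω → α) : α → ℝ :=
  fun a => ∑ ω, if X ω = a then μ ω else 0

/-- Shannon entropy (base 2) of a pmf. -/
def entFun [Fintype α] (p : α → ℝ) : ℝ := - ∑ a, p a * Real.logb 2 (p a)

/-- Shannon entropy `H(X)` of a random variable `X` on `(Ω, μ)`. -/
def H [Fintype Ω] [Fintype α] [DecidableEq α] (μ : Ω → ℝ) (X : Ω → α) : ℝ :=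
  entFun (distr μ X)

/-- Conditional entropy `H(X | Z)`. -/
def condEnt [Fintype Ω] [Fintype α] [Fintype γ] [DecidableEq α] [DecidableEq γ]
    (μ : Ω → ℝ) (X : Ω → α) (Z : Ω → γ) : ℝ :=
  H μ (fun ω => (X ω, Z ω)) - H μ Z

/-- Mutual information `I(X; Y)`. -/
def mi [Fintype Ω] [Fintype α] [Fintype β] [DecidableEq α] [DecidableEq β]
    (μ : Ω → ℝ) (X : Ω → α) (Y : Ω → β) : ℝ :=
  H μ X + H μ Y - H μ (fun ω => (X ω, Y ω))

/-- Conditional mutual information `I(X; Y | Z)`. -/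
def cmi [Fintype Ω] [Fintype α] [Fintype β] [Fintype γ]
    [DecidableEq α] [DecidableEq β] [DecidableEq γ]
    (μ : Ω → ℝ) (X : Ω → α) (Y : Ω → β) (Z : Ω → γ) : ℝ :=
  H μ (fun ω => (X ω, Z ω)) + H μ (fun ω => (Y ω, Z ω))
    - H μ (fun ω => (X ω, Y ω, Z ω)) - H μ Z

section SoftCovering

variable {𝒱 𝒳 : Type} [Fintype 𝒱] [DecidableEq 𝒱] [Fintype 𝒳] [DecidableEq 𝒳]
variable {r : ℕ} {𝓕 : Fin r → Type} [∀ i, Fintype (𝓕 i)] [∀ i, DecidableEq (𝓕 i)]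

/-- The `X`-marginal of `p(f₁,…,f_r, v, x)`. -/
def pXm (p : ((i : Fin r) → 𝓕 i) × 𝒱 × 𝒳 → ℝ) (x : 𝒳) : ℝ :=
  ∑ f, ∑ v, p (f, v, x)

/-- The `(V, X)`-marginal of `p(f₁,…,f_r, v, x)`. -/
def pVXm (p : ((i : Fin r) → 𝓕 i) × 𝒱 × 𝒳 → ℝ) (v : 𝒱) (x : 𝒳) : ℝ :=
  ∑ f, p (f, v, x)

/-- The conditional pmf `p(v | x)` (with the convention `0/0 = 0`). -/
def condVX (p : ((i : Fin r) → 𝓕 i) × 𝒱 × 𝒳 → ℝ) (v : 𝒱) (x : 𝒳) : ℝ :=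
  pVXm p v x / pXm p x

/-- The conditional pmf `p(f_s | f_{1:s-1}, x)` of the level-`s` symbol given the lower
levels and `x` (with the convention `0/0 = 0`). -/
def condF (p : ((i : Fin r) → 𝓕 i) × 𝒱 × 𝒳 → ℝ) (s : Fin r)
    (g : (j : Fin (s : ℕ)) → 𝓕 ⟨j.1, j.2.trans s.2⟩) (x : 𝒳) (fs : 𝓕 s) : ℝ :=
  (∑ f : (i : Fin r) → 𝓕 i, ∑ v : 𝒱,
      if ((fun j : Fin (s : ℕ) => f ⟨j.1, j.2.trans s.2⟩) = g ∧ f s = fs)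
      then p (f, v, x) else 0) /
  (∑ f : (i : Fin r) → 𝓕 i, ∑ v : 𝒱,
      if (fun j : Fin (s : ℕ) => f ⟨j.1, j.2.trans s.2⟩) = g then p (f, v, x) else 0)

/-- The conditional pmf `p(v | f₁,…,f_r, x)` (with the convention `0/0 = 0`). -/
def condVF (p : ((i : Fin r) → 𝓕 i) × 𝒱 × 𝒳 → ℝ) (f : (i : Fin r) → 𝓕 i)
    (x : 𝒳) (v : 𝒱) : ℝ :=
  p (f, v, x) / ∑ v', p (f, v', x)

/-- Number of codewords at level `i` for block length `n`: `2^{n R'_i}` rounded up. -/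
def Ncw (R' : Fin r → ℝ) (n : ℕ) (i : Fin r) : ℕ := ⌈(2 : ℝ) ^ ((n : ℝ) * R' i)⌉₊

/-- A (superposition) codebook of block length `n`: for each level `s` and each index
tuple `(t₁,…,t_{s+1})`, a codeword of length `n` with symbols in `𝓕 s`. -/
abbrev Cb (𝓕 : Fin r → Type) (R' : Fin r → ℝ) (n : ℕ) : Type :=
  (s : Fin r) →
    ((j : Fin ((s : ℕ) + 1)) → Fin (Ncw R' n ⟨j.1, lt_of_lt_of_le j.2 s.2⟩)) →
      Fin n → 𝓕 s

/-- The probability of drawing the codebook `D` in the random superposition-codebook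
construction for the source sequence `x`: each level-`s` codeword is drawn i.i.d. across
coordinates from `p(f_s | ·, x_k)` conditioned on the corresponding lower-level
codewords. -/
def probCb (p : ((i : Fin r) → 𝓕 i) × 𝒱 × 𝒳 → ℝ) (R' : Fin r → ℝ) (n : ℕ)
    (x : Fin n → 𝒳) (D : Cb 𝓕 R' n) : ℝ :=
  ∏ s : Fin r,
    ∏ t : (j : Fin ((s : ℕ) + 1)) → Fin (Ncw R' n ⟨j.1, lt_of_lt_of_le j.2 s.2⟩),
      ∏ k : Fin n,
        condF p s
          (fun j : Fin (s : ℕ) =>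
            D ⟨j.1, j.2.trans s.2⟩
              (fun j' : Fin (j.1 + 1) =>
                t ⟨j'.1, Nat.lt_succ_of_lt (lt_of_lt_of_le j'.2 j.2)⟩) k)
          (x k) (D s t k)

/-- The induced (random) conditional distribution `Q(v_{1:n} | x_{1:n})` of the
soft-covering construction: pick a uniformly random full index tuple and pass the
corresponding codewords through the memoryless channel `p(v | f₁,…,f_r, x)`. -/
def Qdist (p : ((i : Fin r) → 𝓕 i) × 𝒱 × 𝒳 → ℝ) (R' : Fin r → ℝ) (n : ℕ)
    (D : Cb 𝓕 R' n) (x : Fin n → 𝒳) (v : Fin n → 𝒱) : ℝ :=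
  (∏ i : Fin r, (Ncw R' n i : ℝ))⁻¹ *
    ∑ t : (i : Fin r) → Fin (Ncw R' n i),
      ∏ k : Fin n,
        condVF p
          (fun i : Fin r =>
            D i (fun j' : Fin ((i : ℕ) + 1) => t ⟨j'.1, lt_of_lt_of_le j'.2 i.2⟩) k)
          (x k) (v k)

end SoftCovering

section ProductPMF

variable {ι A : Type*} [Fintype ι] [DecidableEq ι] [Fintype A]

/-- The expectation of a function of one coordinate under a product pmf. -/
lemma sum_prod_mul_apply (q : ι → A → ℝ) (hq : ∀ t, ∑ a, q t a = 1) (u : ι) (φ : A → ℝ) :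
    ∑ d : ι → A, (∏ t, q t (d t)) * φ (d u) = ∑ a, q u a * φ a := by
  have h (d : ι → A) : (∏ t, q t (d t)) * φ (d u)
      = ∏ t, (q t (d t) * if t = u then φ (d t) else 1) := by
    rw [Finset.prod_mul_distrib]
    simp
  simp_rw [h]
  rw [← Fintype.prod_sum (fun t a => q t a * if t = u then φ a else 1),
    Finset.prod_eq_single u]
  · simp
  · intro t _ ht
    simp [ht, hq]
  · simp

lemma sum_prod_eq_one (q : ι → A → ℝ) (hq : ∀ t, ∑ a, q t a = 1) :
    ∑ d : ι → A, ∏ t, q t (d t) = 1 := by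
  rw [← Fintype.prod_sum]
  simp [hq]

/-- Distinct coordinates are independent under a product pmf. -/
lemma sum_prod_mul_apply_mul_apply (q : ι → A → ℝ) (hq : ∀ t, ∑ a, q t a = 1) {u w : ι}
    (huw : u ≠ w) (φ ψ : A → ℝ) :
    ∑ d : ι → A, (∏ t, q t (d t)) * (φ (d u) * ψ (d w))
      = (∑ a, q u a * φ a) * ∑ a, q w a * ψ a := by
  have h (d : ι → A) : (∏ t, q t (d t)) * (φ (d u) * ψ (d w))
      = ∏ t, (q t (d t) * ((if t = u then φ (d t) else 1) * if t = w then ψ (d t) else 1)) := by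
    rw [Finset.prod_mul_distrib, Finset.prod_mul_distrib]
    simp
  simp_rw [h]
  rw [← Fintype.prod_sum
      (fun t a => q t a * ((if t = u then φ a else 1) * if t = w then ψ a else 1)),
    Finset.prod_eq_mul u w huw]
  · simp [huw, huw.symm]
  · intro t _ ht
    simp [ht.1, ht.2, hq]
  · simp
  · simp

/-- The second moment of a sum of independent variables is at most the square of its mean plus
the sum of the second moments. -/
lemma sum_prod_mul_sq_le (q : ι → A → ℝ)
    (hq : ∀ t, ∑ a, q t a = 1) (φ : ι → A → ℝ) :
    ∑ d : ι → A, (∏ t, q t (d t)) * (∑ t, φ t (d t)) ^ 2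
      ≤ (∑ t, ∑ a, q t a * φ t a) ^ 2 + ∑ t, ∑ a, q t a * φ t a ^ 2 := by
  have expand : ∑ d : ι → A, (∏ t, q t (d t)) * (∑ t, φ t (d t)) ^ 2
      = ∑ u, ∑ w, ∑ d : ι → A, (∏ t, q t (d t)) * (φ u (d u) * φ w (d w)) := by
    simp_rw [sq, Finset.sum_mul_sum, Finset.mul_sum]
    rw [Finset.sum_comm]
    refine Finset.sum_congr rfl fun u _ => ?_
    rw [Finset.sum_comm]
  have rhs : (∑ t, ∑ a, q t a * φ t a) ^ 2 + ∑ t, ∑ a, q t a * φ t a ^ 2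
      = ∑ u, ∑ w, ((∑ a, q u a * φ u a) * (∑ a, q w a * φ w a)
          + if u = w then ∑ a, q u a * φ u a ^ 2 else 0) := by
    simp_rw [Finset.sum_add_distrib]
    rw [sq, Finset.sum_mul_sum]
    simp
  rw [expand, rhs]
  refine Finset.sum_le_sum fun u _ => Finset.sum_le_sum fun w _ => ?_
  by_cases huw : u = w
  · subst huw
    rw [sum_prod_mul_apply q hq u fun a => φ u a * φ u a]
    simp only [if_true, ← sq]
    nlinarith [sq_nonneg (∑ a, q u a * φ u a)]
  · rw [sum_prod_mul_apply_mul_apply q hq huw]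
    simp [huw]

end ProductPMF

section Codebook

variable {r : ℕ}

/-- A superposition codebook with `N i` branches and symbols in `A i` at level `i`. -/
abbrev Codebook (A : Fin r → Type) (N : Fin r → ℕ) : Type :=
  (s : Fin r) → ((j : Fin ((s : ℕ) + 1)) → Fin (N ⟨j.1, lt_of_lt_of_le j.2 s.2⟩)) → A s

/-- The codewords of `D` along the branch `t`. -/
def Codebook.path {A : Fin r → Type} {N : Fin r → ℕ} (D : Codebook A N)
    (t : (i : Fin r) → Fin (N i)) : (i : Fin r) → A i :=
  fun i => D i (fun j => t ⟨j.1, lt_of_lt_of_le j.2 i.2⟩)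

/-- For each level, a transition kernel from the symbols at the lower levels. -/
abbrev LevelKernel (A : Fin r → Type) : Type :=
  (s : Fin r) → ((j : Fin (s : ℕ)) → A ⟨j.1, j.2.trans s.2⟩) → A s → ℝ

/-- The probability of a sequence of symbols under a chain of kernels. -/
def chainProb {A : Fin r → Type} (K : LevelKernel A) (f : (i : Fin r) → A i) : ℝ :=
  ∏ s, K s (fun j => f ⟨j.1, j.2.trans s.2⟩) (f s)

/-- The probability of a codebook whose codewords are drawn from `K`. -/
def codebookProb {A : Fin r → Type} (N : Fin r → ℕ) (K : LevelKernel A)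
    (D : Codebook A N) : ℝ :=
  ∏ s : Fin r, ∏ t : (j : Fin ((s : ℕ) + 1)) → Fin (N ⟨j.1, lt_of_lt_of_le j.2 s.2⟩),
    K s (fun j => D ⟨j.1, j.2.trans s.2⟩
      (fun j' => t ⟨j'.1, Nat.lt_succ_of_lt (lt_of_lt_of_le j'.2 j.2)⟩)) (D s t)

/-- The average of `h` over the branches of a codebook. -/
def Codebook.mean {A : Fin r → Type} {N : Fin r → ℕ} (D : Codebook A N)
    (h : ((i : Fin r) → A i) → ℝ) : ℝ :=
  (∏ i, (N i : ℝ))⁻¹ * ∑ t : (i : Fin r) → Fin (N i), h (D.path t)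

/-- All kernels are probability kernels. -/
def LevelKernel.IsMarkov {A : Fin r → Type} [∀ i, Fintype (A i)] (K : LevelKernel A) : Prop :=
  ∀ s g, (∀ a, 0 ≤ K s g a) ∧ ∑ a, K s g a = 1

section Succ

variable {A : Fin (r + 1) → Type} {N : Fin (r + 1) → ℕ}

/-- The kernels of all levels but the last. -/
def LevelKernel.lower (K : LevelKernel A) : LevelKernel (fun i : Fin r => A i.castSucc) :=
  fun s => K s.castSucc

/-- The kernel of the last level. -/
def LevelKernel.top (K : LevelKernel A) (f : (i : Fin r) → A i.castSucc) :
    A (Fin.last r) → ℝ :=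
  K (Fin.last r) f

/-- Add a last level to a codebook. -/
def Codebook.snoc (D : Codebook (fun i : Fin r => A i.castSucc) (fun i => N i.castSucc))
    (d : ((i : Fin (r + 1)) → Fin (N i)) → A (Fin.last r)) : Codebook A N :=
  Fin.snoc (α := fun s : Fin (r + 1) =>
    ((j : Fin ((s : ℕ) + 1)) → Fin (N ⟨j.1, lt_of_lt_of_le j.2 s.2⟩)) → A s) D d

lemma Codebook.path_snoc
    (D : Codebook (fun i : Fin r => A i.castSucc) (fun i => N i.castSucc))
    (d : ((i : Fin (r + 1)) → Fin (N i)) → A (Fin.last r)) (t : (i : Fin (r + 1)) → Fin (N i)) :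
    (D.snoc d).path t = Fin.snoc (D.path fun i => t i.castSucc) (d t) := by
  funext i
  refine Fin.lastCases ?_ (fun i => ?_) i
  · simp only [Codebook.path, Codebook.snoc, Fin.snoc_last]
    rfl
  · simp only [Codebook.path, Codebook.snoc, Fin.snoc_castSucc]
    rfl

lemma sum_pi_snoc [∀ i, Fintype (A i)] (φ : ((i : Fin (r + 1)) → A i) → ℝ) :
    ∑ f, φ f = ∑ f : (i : Fin r) → A i.castSucc, ∑ a, φ (Fin.snoc f a) := by
  rw [← (Fin.snocEquiv A).sum_comp, Fintype.sum_prod_type, Finset.sum_comm]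
  rfl

lemma sum_codebook_snoc [∀ i, Fintype (A i)] (φ : Codebook A N → ℝ) :
    ∑ D, φ D = ∑ D : Codebook (fun i : Fin r => A i.castSucc) (fun i => N i.castSucc),
      ∑ d : ((i : Fin (r + 1)) → Fin (N i)) → A (Fin.last r), φ (D.snoc d) := by
  rw [← (Fin.snocEquiv (fun s : Fin (r + 1) =>
    ((j : Fin ((s : ℕ) + 1)) → Fin (N ⟨j.1, lt_of_lt_of_le j.2 s.2⟩)) → A s)).sum_comp,
    Fintype.sum_prod_type, Finset.sum_comm]
  rfl

lemma chainProb_snoc (K : LevelKernel A) (f : (i : Fin r) → A i.castSucc) (a : A (Fin.last r)) :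
    chainProb K (Fin.snoc f a) = chainProb K.lower f * K.top f a := by
  rw [chainProb, Fin.prod_univ_castSucc, chainProb]
  congr 1
  · refine Finset.prod_congr rfl fun s _ => ?_
    rw [Fin.snoc_castSucc]
    unfold LevelKernel.lower
    congr 1
    funext j
    exact Fin.snoc_castSucc (α := A) a f ⟨j.1, j.2.trans s.2⟩
  · rw [Fin.snoc_last]
    unfold LevelKernel.top
    congr 1
    funext j
    exact Fin.snoc_castSucc (α := A) a f j

lemma codebookProb_snoc (K : LevelKernel A)
    (D : Codebook (fun i : Fin r => A i.castSucc) (fun i => N i.castSucc))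
    (d : ((i : Fin (r + 1)) → Fin (N i)) → A (Fin.last r)) :
    codebookProb N K (D.snoc d) = codebookProb (fun i => N i.castSucc) K.lower D *
      ∏ t, K.top (D.path fun i => t i.castSucc) (d t) := by
  have hlow (s : Fin r) : D.snoc d s.castSucc = D s :=
    Fin.snoc_castSucc (α := fun s : Fin (r + 1) =>
      ((j : Fin ((s : ℕ) + 1)) → Fin (N ⟨j.1, lt_of_lt_of_le j.2 s.2⟩)) → A s) d D s
  have htop : D.snoc d (Fin.last r) = d :=
    Fin.snoc_last (α := fun s : Fin (r + 1) =>
      ((j : Fin ((s : ℕ) + 1)) → Fin (N ⟨j.1, lt_of_lt_of_le j.2 s.2⟩)) → A s) d D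
  rw [codebookProb, Fin.prod_univ_castSucc, codebookProb]
  congr 1
  · refine Finset.prod_congr rfl fun s _ => Finset.prod_congr rfl fun t _ => ?_
    rw [hlow]
    unfold LevelKernel.lower
    congr 1
    funext j
    exact congrFun (hlow ⟨j.1, j.2.trans s.2⟩) _
  · refine Finset.prod_congr rfl fun t _ => ?_
    rw [htop]
    unfold LevelKernel.top
    congr 1
    funext j
    exact congrFun (hlow j) _

variable [∀ i, Fintype (A i)]

/-- Average out the last level. -/
def LevelKernel.average (K : LevelKernel A) (h : ((i : Fin (r + 1)) → A i) → ℝ)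
    (f : (i : Fin r) → A i.castSucc) : ℝ :=
  ∑ a, K.top f a * h (Fin.snoc f a)

lemma LevelKernel.IsMarkov.lower {K : LevelKernel A} (hK : K.IsMarkov) : K.lower.IsMarkov :=
  fun s => hK s.castSucc

lemma LevelKernel.IsMarkov.top_nonneg {K : LevelKernel A} (hK : K.IsMarkov)
    (f : (i : Fin r) → A i.castSucc) (a) : 0 ≤ K.top f a :=
  (hK (Fin.last r) f).1 a

lemma LevelKernel.IsMarkov.sum_top {K : LevelKernel A} (hK : K.IsMarkov)
    (f : (i : Fin r) → A i.castSucc) : ∑ a, K.top f a = 1 :=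
  (hK (Fin.last r) f).2

lemma sum_chainProb_mul_average (K : LevelKernel A) (h : ((i : Fin (r + 1)) → A i) → ℝ) :
    ∑ f, chainProb K.lower f * K.average h f = ∑ f, chainProb K f * h f := by
  rw [sum_pi_snoc]
  simp_rw [chainProb_snoc, LevelKernel.average, Finset.mul_sum, mul_assoc]

omit [∀ i, Fintype (A i)] in
lemma Codebook.mean_lower
    (D : Codebook (fun i : Fin r => A i.castSucc) (fun i => N i.castSucc))
    (hN : 0 < N (Fin.last r)) (ψ : ((i : Fin r) → A i.castSucc) → ℝ) :
    (∏ i, (N i : ℝ))⁻¹ * ∑ t : (i : Fin (r + 1)) → Fin (N i), ψ (D.path fun i => t i.castSucc)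
      = D.mean ψ := by
  have : (N (Fin.last r) : ℝ) ≠ 0 := by positivity
  rw [sum_pi_snoc, Fin.prod_univ_castSucc, Codebook.mean]
  simp only [Fin.snoc_castSucc, Finset.sum_const, Finset.card_univ, Fintype.card_fin,
    nsmul_eq_mul, ← Finset.mul_sum]
  field_simp

end Succ

lemma codebookProb_nonneg {A : Fin r → Type} [∀ i, Fintype (A i)] (N : Fin r → ℕ)
    {K : LevelKernel A} (hK : K.IsMarkov) (D : Codebook A N) : 0 ≤ codebookProb N K D :=
  Finset.prod_nonneg fun s _ => Finset.prod_nonneg fun _ _ => (hK s _).1 _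

lemma chainProb_nonneg {A : Fin r → Type} [∀ i, Fintype (A i)]
    {K : LevelKernel A} (hK : K.IsMarkov) (f : (i : Fin r) → A i) : 0 ≤ chainProb K f :=
  Finset.prod_nonneg fun s _ => (hK s _).1 _

lemma sum_codebookProb {A : Fin r → Type} [∀ i, Fintype (A i)] (N : Fin r → ℕ)
    {K : LevelKernel A} (hK : K.IsMarkov) : ∑ D, codebookProb N K D = 1 := by
  induction r with
  | zero => simp [codebookProb]
  | succ r ih =>
    rw [sum_codebook_snoc]
    simp_rw [codebookProb_snoc, ← Finset.mul_sum]
    rw [← ih (fun i => N i.castSucc) hK.lower]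
    refine Finset.sum_congr rfl fun D _ => ?_
    rw [sum_prod_eq_one (fun t : (i : Fin (r + 1)) → Fin (N i) =>
      K.top (D.path fun i => t i.castSucc)) fun t => hK.sum_top _, mul_one]

/-- The expected average over the branches is the expectation along one branch. -/
lemma sum_codebookProb_mul_mean {A : Fin r → Type} [∀ i, Fintype (A i)] {N : Fin r → ℕ}
    (hN : ∀ i, 0 < N i) {K : LevelKernel A} (hK : K.IsMarkov) (h : ((i : Fin r) → A i) → ℝ) :
    ∑ D, codebookProb N K D * D.mean h = ∑ f, chainProb K f * h f := by
  induction r with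
  | zero =>
    simp only [Codebook.mean, codebookProb, chainProb, Finset.univ_unique, Finset.sum_singleton,
      Finset.univ_eq_empty, Finset.prod_empty, inv_one, one_mul]
    exact congrArg h (Subsingleton.elim _ _)
  | succ r ih =>
    rw [sum_codebook_snoc, ← sum_chainProb_mul_average,
      ← ih (fun i => hN i.castSucc) hK.lower (K.average h)]
    refine Finset.sum_congr rfl fun D _ => ?_
    simp_rw [codebookProb_snoc, mul_assoc, ← Finset.mul_sum]
    congr 1
    rw [← D.mean_lower (hN _)]
    simp_rw [Codebook.mean, Codebook.path_snoc, mul_left_comm _ (∏ i, (N i : ℝ))⁻¹,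
      ← Finset.mul_sum]
    congr 1
    simp_rw [Finset.mul_sum]
    rw [Finset.sum_comm]
    refine Finset.sum_congr rfl fun t _ => ?_
    exact sum_prod_mul_apply (fun t : (i : Fin (r + 1)) → Fin (N i) =>
      K.top (D.path fun i => t i.castSucc)) (fun t => hK.sum_top _) t
      fun a => h (Fin.snoc (D.path fun i => t i.castSucc) a)

/-- Second moment of the average over the branches of a random codebook. The hypothesis bounds
the conditional expectation of `h` given the first `s + 1` symbols by `C s`. -/
lemma sum_codebookProb_mul_mean_sq_le {A : Fin r → Type} [∀ i, Fintype (A i)]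
    [∀ i, DecidableEq (A i)] {N : Fin r → ℕ}
    (hN : ∀ i, 0 < N i) {K : LevelKernel A} (hK : K.IsMarkov) {h : ((i : Fin r) → A i) → ℝ}
    (h0 : ∀ f, 0 ≤ h f) {C : Fin r → ℝ}
    (hC : ∀ s (f₀ : (i : Fin r) → A i),
      (∑ f, if ∀ i ≤ s, f i = f₀ i then chainProb K f * h f else 0)
        ≤ C s * ∑ f, if ∀ i ≤ s, f i = f₀ i then chainProb K f else 0) :
    ∑ D, codebookProb N K D * D.mean h ^ 2
      ≤ (∑ f, chainProb K f * h f) ^ 2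
        + ∑ s, (∏ i ∈ Finset.univ.filter (· ≤ s), (N i : ℝ))⁻¹
            * (C s * ∑ f, chainProb K f * h f) := by
  induction r with
  | zero =>
    simp only [Codebook.mean, codebookProb, chainProb, Finset.univ_unique, Finset.sum_singleton,
      Finset.univ_eq_empty, Finset.prod_empty, inv_one, one_mul, Finset.sum_empty, add_zero]
    exact le_of_eq (congrArg (fun f => h f ^ 2) (Subsingleton.elim _ _))
  | succ r ih =>
    have havg0 : ∀ f, 0 ≤ K.average h f := fun f =>
      Finset.sum_nonneg fun a _ => mul_nonneg (hK.top_nonneg f a) (h0 _)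
    have hagree (s : Fin r) (f₀ f : (i : Fin r) → A i.castSucc) (a₀ a : A (Fin.last r)) :
        (∀ i ≤ s.castSucc, (Fin.snoc f a : (i : Fin (r + 1)) → A i) i
            = (Fin.snoc f₀ a₀ : (i : Fin (r + 1)) → A i) i) ↔ ∀ i ≤ s, f i = f₀ i := by
      constructor
      · intro hi i his
        simpa using hi i.castSucc (by simpa using his)
      · intro hi i
        refine Fin.lastCases (fun hl => ?_) (fun i his => ?_) i
        · exact absurd hl (not_le.2 (Fin.castSucc_lt_last s))
        · simpa using hi i (by simpa using his)
    have hC' : ∀ s (f₀ : (i : Fin r) → A i.castSucc),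
        (∑ f, if ∀ i ≤ s, f i = f₀ i then chainProb K.lower f * K.average h f else 0)
          ≤ C s.castSucc * ∑ f, if ∀ i ≤ s, f i = f₀ i then chainProb K.lower f else 0 := by
      intro s f₀
      obtain ⟨a₀⟩ : Nonempty (A (Fin.last r)) := by
        by_contra hne
        rw [not_nonempty_iff] at hne
        simpa using hK.sum_top f₀
      have := hC s.castSucc (Fin.snoc f₀ a₀)
      rw [sum_pi_snoc, sum_pi_snoc] at this
      simp_rw [hagree, chainProb_snoc] at this
      convert this using 2
      · split_ifs
        · simp_rw [LevelKernel.average, Finset.mul_sum, mul_assoc]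
        · simp
      · refine Finset.sum_congr rfl fun f _ => ?_
        split_ifs
        · rw [← Finset.mul_sum, hK.sum_top, mul_one]
        · simp
    have hsq : ∑ f, chainProb K f * h f ^ 2
        ≤ C (Fin.last r) * ∑ f, chainProb K f * h f := by
      rw [Finset.mul_sum]
      refine Finset.sum_le_sum fun f _ => ?_
      have := hC (Fin.last r) f
      have heq (f' : (i : Fin (r + 1)) → A i) : (∀ i ≤ Fin.last r, f' i = f i) ↔ f' = f :=
        ⟨fun hf => funext fun i => hf i (Fin.le_last i), fun hf i _ => congrFun hf i⟩
      simp only [heq, Finset.sum_ite_eq', Finset.mem_univ, if_true] at this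
      nlinarith [h0 f]
    have key (D : Codebook (fun i : Fin r => A i.castSucc) (fun i => N i.castSucc)) :
        ∑ d : ((i : Fin (r + 1)) → Fin (N i)) → A (Fin.last r),
          (∏ t, K.top (D.path fun i => t i.castSucc) (d t)) * (D.snoc d).mean h ^ 2
        ≤ D.mean (K.average h) ^ 2
          + (∏ i, (N i : ℝ))⁻¹ * D.mean (K.average fun f => h f ^ 2) := by
      have := sum_prod_mul_sq_le (fun t : (i : Fin (r + 1)) → Fin (N i) =>
        K.top (D.path fun i => t i.castSucc)) (fun t => hK.sum_top _)
        fun t a => h (Fin.snoc (D.path fun i => t i.castSucc) a)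
      have hmean (d : ((i : Fin (r + 1)) → Fin (N i)) → A (Fin.last r)) :
          (D.snoc d).mean h = (∏ i, (N i : ℝ))⁻¹ *
            ∑ t, h (Fin.snoc (D.path fun i => t i.castSucc) (d t)) := by
        simp_rw [Codebook.mean, Codebook.path_snoc]
      simp_rw [hmean, mul_pow, mul_left_comm _ ((∏ i, (N i : ℝ))⁻¹ ^ 2), ← Finset.mul_sum]
      rw [← D.mean_lower (hN _), ← D.mean_lower (hN _)]
      refine (mul_le_mul_of_nonneg_left this (by positivity)).trans (le_of_eq ?_)
      unfold LevelKernel.average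
      ring
    rw [sum_codebook_snoc]
    simp_rw [codebookProb_snoc, mul_assoc, ← Finset.mul_sum]
    refine (Finset.sum_le_sum fun D _ => mul_le_mul_of_nonneg_left (key D)
      (codebookProb_nonneg _ hK.lower D)).trans ?_
    simp_rw [mul_add, Finset.sum_add_distrib, mul_left_comm _ (∏ i, (N i : ℝ))⁻¹,
      ← Finset.mul_sum]
    rw [sum_codebookProb_mul_mean (fun i => hN i.castSucc) hK.lower, sum_chainProb_mul_average]
    have hih := ih (fun i => hN i.castSucc) hK.lower havg0 hC'
    rw [sum_chainProb_mul_average] at hih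
    rw [Fin.sum_univ_castSucc, ← add_assoc]
    refine add_le_add (hih.trans (le_of_eq ?_)) ?_
    · congr 1
      refine Finset.sum_congr rfl fun s _ => ?_
      congr 2
      simp_rw [Finset.prod_filter]
      rw [Fin.prod_univ_castSucc]
      simp [not_le.2 (Fin.castSucc_lt_last s)]
    · simp only [Fin.le_last, Finset.filter_true]
      exact mul_le_mul_of_nonneg_left hsq (by positivity)

lemma Codebook.mean_sub {A : Fin r → Type} {N : Fin r → ℕ} (D : Codebook A N)
    (g h : ((i : Fin r) → A i) → ℝ) : D.mean (fun f => g f - h f) = D.mean g - D.mean h := by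
  simp only [Codebook.mean, Finset.sum_sub_distrib, mul_sub]

/-- The expected distance between the average of `g` over a random codebook and its expectation,
in terms of a truncation `h` of `g`. -/
lemma sum_codebookProb_mul_abs_mean_sub_le {A : Fin r → Type} [∀ i, Fintype (A i)]
    [∀ i, DecidableEq (A i)] {N : Fin r → ℕ} (hN : ∀ i, 0 < N i) {K : LevelKernel A}
    (hK : K.IsMarkov) {g h : ((i : Fin r) → A i) → ℝ} (h0 : ∀ f, 0 ≤ h f)
    (hg : ∀ f, h f ≤ g f) {c : Fin r → ℝ} (hc : ∀ s, 0 ≤ c s)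
    (hC : ∀ s (f₀ : (i : Fin r) → A i),
      (∑ f, if ∀ i ≤ s, f i = f₀ i then chainProb K f * h f else 0)
        ≤ c s * (∑ f, chainProb K f * g f)
          * ∑ f, if ∀ i ≤ s, f i = f₀ i then chainProb K f else 0) :
    ∑ D, codebookProb N K D * |D.mean g - ∑ f, chainProb K f * g f|
      ≤ (∑ f, chainProb K f * g f)
          * √(∑ s, (∏ i ∈ Finset.univ.filter (· ≤ s), (N i : ℝ))⁻¹ * c s)
        + 2 * ∑ f, chainProb K f * (g f - h f) := by
  set P := ∑ f, chainProb K f * g f with hP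
  set μ := ∑ f, chainProb K f * h f with hμ
  have hμ0 : 0 ≤ μ := Finset.sum_nonneg fun f _ => mul_nonneg (chainProb_nonneg hK f) (h0 f)
  have hμP : μ ≤ P := Finset.sum_le_sum fun f _ =>
    mul_le_mul_of_nonneg_left (hg f) (chainProb_nonneg hK f)
  have hdiff : ∑ f, chainProb K f * (g f - h f) = P - μ := by
    simp_rw [mul_sub, Finset.sum_sub_distrib]
    rfl
  have hpt (D : Codebook A N) : |D.mean g - P|
      ≤ |D.mean h - μ| + D.mean (fun f => g f - h f) + (P - μ) := by
    have h1 : 0 ≤ D.mean (fun f => g f - h f) :=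
      mul_nonneg (by positivity) (Finset.sum_nonneg fun t _ => sub_nonneg.2 (hg _))
    have h2 : D.mean g - P = (D.mean h - μ) + D.mean (fun f => g f - h f) - (P - μ) := by
      rw [D.mean_sub]; ring
    rw [h2]
    refine (abs_sub _ _).trans (add_le_add ((abs_add_le _ _).trans ?_) ?_)
    · rw [abs_of_nonneg h1]
    · rw [abs_of_nonneg (sub_nonneg.2 hμP)]
  have hsecond := sum_codebookProb_mul_mean_sq_le hN hK h0 hC
  have hvar : ∑ D, codebookProb N K D * (D.mean h - μ) ^ 2
      ≤ P ^ 2 * ∑ s, (∏ i ∈ Finset.univ.filter (· ≤ s), (N i : ℝ))⁻¹ * c s := by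
    have hexp : ∑ D, codebookProb N K D * (D.mean h - μ) ^ 2
        = ∑ D, codebookProb N K D * D.mean h ^ 2 - μ ^ 2 := by
      have : ∀ D : Codebook A N, codebookProb N K D * (D.mean h - μ) ^ 2
          = codebookProb N K D * D.mean h ^ 2 - 2 * μ * (codebookProb N K D * D.mean h)
            + codebookProb N K D * μ ^ 2 := fun D => by ring
      simp_rw [this, Finset.sum_add_distrib, Finset.sum_sub_distrib, ← Finset.mul_sum,
        ← Finset.sum_mul]
      rw [sum_codebookProb_mul_mean hN hK, sum_codebookProb N hK, ← hμ]
      ring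
    rw [hexp, sub_le_iff_le_add']
    refine hsecond.trans ?_
    rw [← hμ, Finset.mul_sum]
    refine add_le_add_right (Finset.sum_le_sum fun s _ => ?_) _
    have : c s * P * μ ≤ c s * P * P :=
      mul_le_mul_of_nonneg_left hμP (mul_nonneg (hc s) (hμ0.trans hμP))
    calc _ ≤ (∏ i ∈ Finset.univ.filter (· ≤ s), (N i : ℝ))⁻¹ * (c s * P * P) :=
          mul_le_mul_of_nonneg_left this (by positivity)
      _ = _ := by ring
  have hfirst : ∑ D, codebookProb N K D * |D.mean h - μ|
      ≤ P * √(∑ s, (∏ i ∈ Finset.univ.filter (· ≤ s), (N i : ℝ))⁻¹ * c s) := by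
    have hcs := Finset.sum_sq_le_sum_mul_sum_of_sq_le_mul (Finset.univ (α := Codebook A N))
      (r := fun D => codebookProb N K D * |D.mean h - μ|)
      (f := fun D => codebookProb N K D)
      (g := fun D => codebookProb N K D * (D.mean h - μ) ^ 2)
      (fun D _ => codebookProb_nonneg N hK D)
      (fun D _ => mul_nonneg (codebookProb_nonneg N hK D) (sq_nonneg _))
      (fun D _ => le_of_eq (by rw [mul_pow, sq_abs]; ring))
    rw [sum_codebookProb N hK, one_mul] at hcs
    have h3 := Real.le_sqrt_of_sq_le (hcs.trans hvar)
    rwa [Real.sqrt_mul (sq_nonneg P), Real.sqrt_sq (hμ0.trans hμP)] at h3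
  calc _ ≤ ∑ D, codebookProb N K D *
        (|D.mean h - μ| + D.mean (fun f => g f - h f) + (P - μ)) :=
        Finset.sum_le_sum fun D _ =>
          mul_le_mul_of_nonneg_left (hpt D) (codebookProb_nonneg N hK D)
    _ = ∑ D, codebookProb N K D * |D.mean h - μ| + 2 * (P - μ) := by
        simp_rw [mul_add, Finset.sum_add_distrib, ← Finset.sum_mul]
        rw [sum_codebookProb_mul_mean hN hK, sum_codebookProb N hK, hdiff]
        ring
    _ ≤ _ := by rw [hdiff]; gcongr

end Codebook

section Chebyshev

variable {Ω : Type*} [Fintype Ω]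

/-- Weak law of large numbers for a centered function of an i.i.d. sequence. -/
lemma sum_prod_ite_lt_sum_le {p : Ω → ℝ} (hp : IsPMF p) {φ : Ω → ℝ}
    (hφ : ∑ ω, p ω * φ ω = 0) {δ : ℝ} (hδ : 0 < δ) {n : ℕ} (hn : 0 < n) :
    ∑ ω : Fin n → Ω, (if n * δ < ∑ k, φ (ω k) then ∏ k, p (ω k) else 0)
      ≤ (∑ ω, p ω * φ ω ^ 2) / δ ^ 2 * (n : ℝ)⁻¹ := by
  have hsq := sum_prod_mul_sq_le (fun _ : Fin n => p) (fun _ => hp.2) (fun _ => φ)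
  simp only [hφ, Finset.sum_const, Finset.card_univ, Fintype.card_fin, nsmul_eq_mul, mul_zero,
    ne_eq, OfNat.ofNat_ne_zero, not_false_eq_true, zero_pow, zero_add] at hsq
  have hn' : (0 : ℝ) < n := by exact_mod_cast hn
  have hbound : (n * δ) ^ 2 *
      ∑ ω : Fin n → Ω, (if n * δ < ∑ k, φ (ω k) then ∏ k, p (ω k) else 0)
      ≤ n * ∑ ω, p ω * φ ω ^ 2 := by
    refine le_trans ?_ hsq
    rw [Finset.mul_sum]
    refine Finset.sum_le_sum fun ω _ => ?_
    have h0 : 0 ≤ ∏ k, p (ω k) := Finset.prod_nonneg fun k _ => hp.1 _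
    split_ifs with h
    · rw [mul_comm]
      exact mul_le_mul_of_nonneg_left (pow_le_pow_left₀ (by positivity) h.le 2) h0
    · rw [mul_zero]
      positivity
  rw [← div_eq_mul_inv, div_div, le_div_iff₀ (by positivity)]
  refine le_of_mul_le_mul_left ?_ hn'
  linarith

end Chebyshev

section SingleLetter

variable {𝒱 𝒳 : Type} [Fintype 𝒱] {r : ℕ} {𝓕 : Fin r → Type} [∀ i, Fintype (𝓕 i)]
  [∀ i, DecidableEq (𝓕 i)]

/-- The marginal of `p` on `(F₁,…,F_m, V, X)`. -/
def marginalFVX (p : ((i : Fin r) → 𝓕 i) × 𝒱 × 𝒳 → ℝ) (m : ℕ)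
    (a : ((i : Fin r) → 𝓕 i) × 𝒱 × 𝒳) : ℝ :=
  ∑ f, if ∀ i : Fin r, (i : ℕ) < m → f i = a.1 i then p (f, a.2) else 0

/-- The marginal of `p` on `(F₁,…,F_m, X)`. -/
def marginalFX (p : ((i : Fin r) → 𝓕 i) × 𝒱 × 𝒳 → ℝ) (m : ℕ)
    (f : (i : Fin r) → 𝓕 i) (x : 𝒳) : ℝ :=
  ∑ f', if ∀ i : Fin r, (i : ℕ) < m → f' i = f i then ∑ v, p (f', v, x) else 0

variable {p : ((i : Fin r) → 𝓕 i) × 𝒱 × 𝒳 → ℝ}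

lemma marginalFX_zero (f : (i : Fin r) → 𝓕 i) (x : 𝒳) : marginalFX p 0 f x = pXm p x := by
  simp [marginalFX, pXm]

lemma marginalFX_self (f : (i : Fin r) → 𝓕 i) (x : 𝒳) :
    marginalFX p r f x = ∑ v, p (f, v, x) := by
  have (f' : (i : Fin r) → 𝓕 i) : (∀ i : Fin r, (i : ℕ) < r → f' i = f i) ↔ f' = f :=
    ⟨fun h => funext fun i => h i i.2, fun h i _ => congrFun h i⟩
  simp only [marginalFX, this, Finset.sum_ite_eq', Finset.mem_univ, if_true]

/-- The conditional pmf `p(f_s | f_{1:s-1}, x)`, taken uniform where `condF` is `0/0`. -/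
def kernelF (p : ((i : Fin r) → 𝓕 i) × 𝒱 × 𝒳 → ℝ) (s : Fin r)
    (g : (j : Fin (s : ℕ)) → 𝓕 ⟨j.1, j.2.trans s.2⟩) (x : 𝒳) (fs : 𝓕 s) : ℝ :=
  if (∑ f : (i : Fin r) → 𝓕 i, ∑ v : 𝒱,
      if (fun j : Fin (s : ℕ) => f ⟨j.1, j.2.trans s.2⟩) = g then p (f, v, x) else 0) = 0
  then (Fintype.card (𝓕 s) : ℝ)⁻¹ else condF p s g x fs

lemma condF_nonneg (hp : ∀ a, 0 ≤ p a) (s : Fin r)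
    (g : (j : Fin (s : ℕ)) → 𝓕 ⟨j.1, j.2.trans s.2⟩) (x : 𝒳) (fs : 𝓕 s) :
    0 ≤ condF p s g x fs := by
  refine div_nonneg ?_ ?_ <;>
  · refine Finset.sum_nonneg fun f _ => Finset.sum_nonneg fun v _ => ?_
    split_ifs
    exacts [hp _, le_rfl]

lemma kernelF_nonneg (hp : ∀ a, 0 ≤ p a) (s : Fin r)
    (g : (j : Fin (s : ℕ)) → 𝓕 ⟨j.1, j.2.trans s.2⟩) (x : 𝒳) (fs : 𝓕 s) :
    0 ≤ kernelF p s g x fs := by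
  unfold kernelF
  split_ifs
  exacts [by positivity, condF_nonneg hp s g x fs]

lemma condF_le_kernelF (s : Fin r)
    (g : (j : Fin (s : ℕ)) → 𝓕 ⟨j.1, j.2.trans s.2⟩) (x : 𝒳) (fs : 𝓕 s) :
    condF p s g x fs ≤ kernelF p s g x fs := by
  unfold kernelF
  split_ifs with h
  · rw [condF, h, div_zero]
    positivity
  · exact le_rfl

lemma sum_kernelF (s : Fin r) [Nonempty (𝓕 s)]
    (g : (j : Fin (s : ℕ)) → 𝓕 ⟨j.1, j.2.trans s.2⟩) (x : 𝒳) :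
    ∑ fs, kernelF p s g x fs = 1 := by
  unfold kernelF
  split_ifs with h
  · simp
  · unfold condF
    rw [← Finset.sum_div, div_eq_one_iff_eq h, Finset.sum_comm]
    refine Finset.sum_congr rfl fun f _ => ?_
    rw [Finset.sum_comm]
    refine Finset.sum_congr rfl fun v _ => ?_
    by_cases hg : (fun j : Fin (s : ℕ) => f ⟨j.1, j.2.trans s.2⟩) = g <;> simp [hg]

lemma sum_ite_prefix_eq_marginalFX (s : Fin r) (f : (i : Fin r) → 𝓕 i) (x : 𝒳) :
    (∑ f' : (i : Fin r) → 𝓕 i, ∑ v : 𝒱,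
      if (fun j : Fin (s : ℕ) => f' ⟨j.1, j.2.trans s.2⟩)
          = (fun j : Fin (s : ℕ) => f ⟨j.1, j.2.trans s.2⟩)
      then p (f', v, x) else 0) = marginalFX p s f x := by
  refine Finset.sum_congr rfl fun f' _ => ?_
  have : ((fun j : Fin (s : ℕ) => f' ⟨j.1, j.2.trans s.2⟩)
        = fun j : Fin (s : ℕ) => f ⟨j.1, j.2.trans s.2⟩)
      ↔ ∀ i : Fin r, (i : ℕ) < s → f' i = f i :=
    ⟨fun h i hi => congrFun h ⟨i, hi⟩, fun h => funext fun j => h _ j.2⟩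
  simp only [this]
  split_ifs <;> simp

lemma sum_ite_prefix_and_eq_marginalFX (s : Fin r) (f : (i : Fin r) → 𝓕 i) (x : 𝒳) :
    (∑ f' : (i : Fin r) → 𝓕 i, ∑ v : 𝒱,
      if (fun j : Fin (s : ℕ) => f' ⟨j.1, j.2.trans s.2⟩)
          = (fun j : Fin (s : ℕ) => f ⟨j.1, j.2.trans s.2⟩)
        ∧ f' s = f s
      then p (f', v, x) else 0) = marginalFX p (s + 1) f x := by
  refine Finset.sum_congr rfl fun f' _ => ?_
  have : ((fun j : Fin (s : ℕ) => f' ⟨j.1, j.2.trans s.2⟩)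
        = (fun j : Fin (s : ℕ) => f ⟨j.1, j.2.trans s.2⟩)
      ∧ f' s = f s) ↔ ∀ i : Fin r, (i : ℕ) < s + 1 → f' i = f i := by
    constructor
    · rintro ⟨h1, h2⟩ i hi
      rcases Nat.lt_succ_iff_lt_or_eq.1 hi with hi | hi
      · exact congrFun h1 ⟨i, hi⟩
      · rw [Fin.ext hi]
        exact h2
    · exact fun h => ⟨funext fun j => h _ (Nat.lt_succ_of_lt j.2), h s (Nat.lt_succ_self _)⟩
  simp only [this]
  split_ifs <;> simp

lemma marginalFX_succ_le (hp : ∀ a, 0 ≤ p a) (m : ℕ) (f : (i : Fin r) → 𝓕 i) (x : 𝒳) :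
    marginalFX p (m + 1) f x ≤ marginalFX p m f x := by
  refine Finset.sum_le_sum fun f' _ => ?_
  have h0 : 0 ≤ ∑ v, p (f', v, x) := Finset.sum_nonneg fun v _ => hp _
  split_ifs with h1 h2 h2
  · exact le_rfl
  · exact absurd (fun i hi => h1 i (Nat.lt_succ_of_lt hi)) h2
  · exact h0
  · exact le_rfl

lemma marginalFX_nonneg (hp : ∀ a, 0 ≤ p a) (m : ℕ) (f : (i : Fin r) → 𝓕 i) (x : 𝒳) :
    0 ≤ marginalFX p m f x := by
  refine Finset.sum_nonneg fun f' _ => ?_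
  split_ifs
  exacts [Finset.sum_nonneg fun v _ => hp _, le_rfl]

lemma marginalFX_mul_kernelF (hp : ∀ a, 0 ≤ p a) (s : Fin r) (f : (i : Fin r) → 𝓕 i) (x : 𝒳) :
    marginalFX p s f x * kernelF p s (fun j => f ⟨j.1, j.2.trans s.2⟩) x (f s)
      = marginalFX p (s + 1) f x := by
  rw [kernelF, condF, sum_ite_prefix_eq_marginalFX, sum_ite_prefix_and_eq_marginalFX]
  split_ifs with h
  · rw [h, zero_mul]
    exact le_antisymm (marginalFX_nonneg hp _ f x) (h ▸ marginalFX_succ_le hp s f x)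
  · exact mul_div_cancel₀ _ h

/-- The chain rule for `p(f₁,…,f_r, x)`. -/
lemma pXm_mul_prod_kernelF (hp : ∀ a, 0 ≤ p a) (f : (i : Fin r) → 𝓕 i) (x : 𝒳) :
    pXm p x * ∏ s : Fin r, kernelF p s (fun j => f ⟨j.1, j.2.trans s.2⟩) x (f s)
      = ∑ v, p (f, v, x) := by
  have key : ∀ m ≤ r, pXm p x * ∏ s ∈ Finset.univ.filter (fun s : Fin r => (s : ℕ) < m),
      kernelF p s (fun j => f ⟨j.1, j.2.trans s.2⟩) x (f s) = marginalFX p m f x := by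
    intro m
    induction m with
    | zero => simp [marginalFX_zero]
    | succ m ih =>
      intro hm
      have hins : Finset.univ.filter (fun s : Fin r => (s : ℕ) < m + 1)
          = insert ⟨m, hm⟩ (Finset.univ.filter fun s : Fin r => (s : ℕ) < m) := by
        ext s
        simp only [Finset.mem_filter, Finset.mem_univ, true_and, Finset.mem_insert, Fin.ext_iff]
        omega
      rw [hins, Finset.prod_insert (by simp), mul_left_comm, ih (Nat.le_of_succ_le hm), mul_comm]
      exact marginalFX_mul_kernelF hp ⟨m, hm⟩ f x
  rw [← marginalFX_self, ← key r le_rfl]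
  simp

omit [∀ i, Fintype (𝓕 i)] [∀ i, DecidableEq (𝓕 i)] in
lemma sum_mul_condVF (hp : ∀ a, 0 ≤ p a) (f : (i : Fin r) → 𝓕 i) (x : 𝒳) (v : 𝒱) :
    (∑ v', p (f, v', x)) * condVF p f x v = p (f, v, x) := by
  unfold condVF
  by_cases h : ∑ v', p (f, v', x) = 0
  · rw [h, zero_mul, (Finset.sum_eq_zero_iff_of_nonneg fun v _ => hp _).1 h v (Finset.mem_univ _)]
  · exact mul_div_cancel₀ _ h

section Information

omit [Fintype 𝒱] in
lemma marginalFVX_congr {m : ℕ} {f f' : (i : Fin r) → 𝓕 i}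
    (h : ∀ i : Fin r, (i : ℕ) < m → f i = f' i) (b : 𝒱 × 𝒳) :
    marginalFVX p m (f, b) = marginalFVX p m (f', b) := by
  have (g : (i : Fin r) → 𝓕 i) : (∀ i : Fin r, (i : ℕ) < m → g i = f i)
      ↔ ∀ i : Fin r, (i : ℕ) < m → g i = f' i :=
    forall₂_congr fun i hi => by rw [h i hi]
  simp only [marginalFVX, this]

lemma marginalFX_congr {m : ℕ} {f f' : (i : Fin r) → 𝓕 i}
    (h : ∀ i : Fin r, (i : ℕ) < m → f i = f' i) (x : 𝒳) :
    marginalFX p m f x = marginalFX p m f' x := by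
  have (g : (i : Fin r) → 𝓕 i) : (∀ i : Fin r, (i : ℕ) < m → g i = f i)
      ↔ ∀ i : Fin r, (i : ℕ) < m → g i = f' i :=
    forall₂_congr fun i hi => by rw [h i hi]
  simp only [marginalFX, this]

lemma H_eq_sum {Ω α : Type*} [Fintype Ω] [Fintype α] [DecidableEq α] (μ : Ω → ℝ) (X : Ω → α) :
    H μ X = -∑ ω, μ ω * Real.logb 2 (distr μ X (X ω)) := by
  have : ∀ a, distr μ X a * Real.logb 2 (distr μ X a)
      = ∑ ω, if X ω = a then μ ω * Real.logb 2 (distr μ X (X ω)) else 0 := by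
    intro a
    change (∑ ω, if X ω = a then μ ω else 0) * _ = _
    rw [Finset.sum_mul]
    refine Finset.sum_congr rfl fun ω _ => ?_
    split_ifs with h
    · rw [h]
    · rw [zero_mul]
  rw [H, entFun]
  simp_rw [this]
  rw [Finset.sum_comm]
  simp

/-- The information density between `V` and `(F₁,…,F_m)` given `X`. -/
def infoDensity (p : ((i : Fin r) → 𝓕 i) × 𝒱 × 𝒳 → ℝ) (m : ℕ)
    (a : ((i : Fin r) → 𝓕 i) × 𝒱 × 𝒳) : ℝ :=
  Real.logb 2 (marginalFVX p m a * pXm p a.2.2)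
    - Real.logb 2 (pVXm p a.2.1 a.2.2 * marginalFX p m a.1 a.2.2)

omit [Fintype 𝒱] in
lemma le_marginalFVX (hp : ∀ a, 0 ≤ p a) (m : ℕ) (a : ((i : Fin r) → 𝓕 i) × 𝒱 × 𝒳) :
    p a ≤ marginalFVX p m a := by
  refine le_trans (le_of_eq ?_) (Finset.single_le_sum (f := fun f : (i : Fin r) → 𝓕 i =>
    if ∀ i : Fin r, (i : ℕ) < m → f i = a.1 i then p (f, a.2) else 0)
    (fun f _ => ?_) (Finset.mem_univ a.1))
  · simp
  · split_ifs
    exacts [hp _, le_rfl]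

lemma le_marginalFX (hp : ∀ a, 0 ≤ p a) (m : ℕ) (a : ((i : Fin r) → 𝓕 i) × 𝒱 × 𝒳) :
    p a ≤ marginalFX p m a.1 a.2.2 := by
  refine le_trans ?_ (Finset.single_le_sum (f := fun f : (i : Fin r) → 𝓕 i =>
    if ∀ i : Fin r, (i : ℕ) < m → f i = a.1 i then ∑ v, p (f, v, a.2.2) else 0)
    (fun f _ => ?_) (Finset.mem_univ a.1))
  · simpa using Finset.single_le_sum (f := fun v => p (a.1, v, a.2.2)) (fun v _ => hp _)
      (Finset.mem_univ a.2.1)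
  · split_ifs
    exacts [Finset.sum_nonneg fun v _ => hp _, le_rfl]

omit [Fintype 𝒱] in
lemma le_pVXm (hp : ∀ a, 0 ≤ p a) (a : ((i : Fin r) → 𝓕 i) × 𝒱 × 𝒳) :
    p a ≤ pVXm p a.2.1 a.2.2 := by
  simpa [marginalFVX, pVXm] using le_marginalFVX hp 0 a

lemma le_pXm (hp : ∀ a, 0 ≤ p a) (a : ((i : Fin r) → 𝓕 i) × 𝒱 × 𝒳) :
    p a ≤ pXm p a.2.2 := by
  simpa [marginalFX_zero] using le_marginalFX hp 0 a

lemma cmi_eq_sum_mul_infoDensity [DecidableEq 𝒱] [Fintype 𝒳] [DecidableEq 𝒳]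
    (hp : ∀ a, 0 ≤ p a) (s : Fin r) :
    cmi p (fun a => a.2.1)
        (fun a => (fun j : Fin ((s : ℕ) + 1) => a.1 ⟨j.1, lt_of_lt_of_le j.2 s.2⟩))
        (fun a => a.2.2)
      = ∑ a, p a * infoDensity p (s + 1) a := by
  have hagree (f f' : (i : Fin r) → 𝓕 i) :
      ((fun j : Fin ((s : ℕ) + 1) => f ⟨j.1, lt_of_lt_of_le j.2 s.2⟩)
        = fun j : Fin ((s : ℕ) + 1) => f' ⟨j.1, lt_of_lt_of_le j.2 s.2⟩)
      ↔ ∀ i : Fin r, (i : ℕ) < s + 1 → f i = f' i :=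
    ⟨fun h i hi => congrFun h ⟨i, hi⟩, fun h => funext fun j => h _ j.2⟩
  have hX (x : 𝒳) : distr p (fun a => a.2.2) x = pXm p x := by
    simp [distr, pXm, Fintype.sum_prod_type]
  have hVX (v : 𝒱) (x : 𝒳) : distr p (fun a => (a.2.1, a.2.2)) (v, x) = pVXm p v x := by
    simp [distr, pVXm, Fintype.sum_prod_type]
  have hFX (a : ((i : Fin r) → 𝓕 i) × 𝒱 × 𝒳) :
      distr p (fun a =>
        ((fun j : Fin ((s : ℕ) + 1) => a.1 ⟨j.1, lt_of_lt_of_le j.2 s.2⟩), a.2.2))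
        ((fun j : Fin ((s : ℕ) + 1) => a.1 ⟨j.1, lt_of_lt_of_le j.2 s.2⟩), a.2.2)
      = marginalFX p (s + 1) a.1 a.2.2 := by
    simp only [distr, marginalFX, Fintype.sum_prod_type, Prod.mk.injEq, hagree, ite_and]
    refine Finset.sum_congr rfl fun f _ => ?_
    split_ifs <;> simp
  have hVFX (a : ((i : Fin r) → 𝓕 i) × 𝒱 × 𝒳) :
      distr p (fun a =>
        (a.2.1, (fun j : Fin ((s : ℕ) + 1) => a.1 ⟨j.1, lt_of_lt_of_le j.2 s.2⟩), a.2.2))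
        (a.2.1, (fun j : Fin ((s : ℕ) + 1) => a.1 ⟨j.1, lt_of_lt_of_le j.2 s.2⟩), a.2.2)
      = marginalFVX p (s + 1) a := by
    simp only [distr, marginalFVX, Fintype.sum_prod_type, Prod.mk.injEq, hagree, ite_and]
    refine Finset.sum_congr rfl fun f _ => ?_
    split_ifs <;> simp
  simp only [cmi, H_eq_sum, hX, hVX, hFX, hVFX]
  rw [← sub_eq_zero, ← Finset.sum_neg_distrib, ← Finset.sum_neg_distrib,
    ← Finset.sum_neg_distrib, ← Finset.sum_neg_distrib, ← Finset.sum_add_distrib,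
    ← Finset.sum_sub_distrib, ← Finset.sum_sub_distrib, ← Finset.sum_sub_distrib]
  refine Finset.sum_eq_zero fun a _ => ?_
  rcases (hp a).eq_or_lt with h0 | h0
  · simp [← h0]
  · rw [infoDensity,
      Real.logb_mul (h0.trans_le (le_marginalFVX hp _ a)).ne' (h0.trans_le (le_pXm hp a)).ne',
      Real.logb_mul (h0.trans_le (le_pVXm hp a)).ne' (h0.trans_le (le_marginalFX hp _ a)).ne']
    ring

/-- At every level the likelihood ratio of the block `ω` is at most `c`. -/
def RatioBounded (p : ((i : Fin r) → 𝓕 i) × 𝒱 × 𝒳 → ℝ) (c : Fin r → ℝ) {n : ℕ}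
    (ω : Fin n → ((i : Fin r) → 𝓕 i) × 𝒱 × 𝒳) : Prop :=
  ∀ s : Fin r, ∏ k, (marginalFVX p (s + 1) (ω k) * pXm p (ω k).2.2)
    ≤ c s * ∏ k, (pVXm p (ω k).2.1 (ω k).2.2 * marginalFX p (s + 1) (ω k).1 (ω k).2.2)

open Classical in
lemma sum_ite_not_ratioBounded_le [Fintype 𝒳] (hp : IsPMF p) {I δ : Fin r → ℝ}
    (hI : ∀ s : Fin r, ∑ a, p a * infoDensity p (s + 1) a = I s) (hδ : ∀ s, 0 < δ s)
    {n : ℕ} (hn : 0 < n) :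
    ∑ ω : Fin n → ((i : Fin r) → 𝓕 i) × 𝒱 × 𝒳,
        (if RatioBounded p (fun s => 2 ^ (n * (I s + δ s))) ω then 0 else ∏ k, p (ω k))
      ≤ (∑ s : Fin r, (∑ a, p a * (infoDensity p (s + 1) a - I s) ^ 2) / δ s ^ 2)
          * (n : ℝ)⁻¹ := by
  rw [Finset.sum_mul]
  refine le_trans ?_ (Finset.sum_le_sum fun s _ => sum_prod_ite_lt_sum_le hp
    (φ := fun a => infoDensity p (s + 1) a - I s) ?_ (hδ s) hn)
  · rw [Finset.sum_comm]
    refine Finset.sum_le_sum fun ω _ => ?_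
    have h0 : 0 ≤ ∏ k, p (ω k) := Finset.prod_nonneg fun k _ => hp.1 _
    have hterm (s : Fin r) : 0 ≤ if n * δ s < ∑ k, (infoDensity p (s + 1) (ω k) - I s)
        then ∏ k, p (ω k) else 0 := by
      split_ifs
      exacts [h0, le_rfl]
    split_ifs with hR
    · exact Finset.sum_nonneg fun s _ => hterm s
    rcases h0.eq_or_lt with hz | hpos
    · rw [← hz]
      simp
    have hk (k) : 0 < p (ω k) := (hp.1 _).lt_of_ne fun h =>
      hpos.ne' (Finset.prod_eq_zero (Finset.mem_univ k) h.symm)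
    unfold RatioBounded at hR
    push Not at hR
    obtain ⟨s, hs⟩ := hR
    refine le_trans (le_of_eq ?_) (Finset.single_le_sum (fun s _ => hterm s) (Finset.mem_univ s))
    rw [if_pos]
    have h1 (k) : 0 < marginalFVX p (s + 1) (ω k) * pXm p (ω k).2.2 :=
      mul_pos ((hk k).trans_le (le_marginalFVX hp.1 _ _)) ((hk k).trans_le (le_pXm hp.1 _))
    have h2 (k) : 0 < pVXm p (ω k).2.1 (ω k).2.2 * marginalFX p (s + 1) (ω k).1 (ω k).2.2 :=
      mul_pos ((hk k).trans_le (le_pVXm hp.1 _)) ((hk k).trans_le (le_marginalFX hp.1 _ _))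
    have h3 := Finset.prod_pos fun k (_ : k ∈ Finset.univ) => h2 k
    have hlog := Real.logb_lt_logb one_lt_two (by positivity) hs
    rw [Real.logb_mul (by positivity) h3.ne', Real.logb_rpow two_pos (by norm_num),
      Real.logb_prod _ _ fun k _ => (h1 k).ne', Real.logb_prod _ _ fun k _ => (h2 k).ne'] at hlog
    simp only [infoDensity, Finset.sum_sub_distrib, Finset.sum_const, Finset.card_univ,
      Fintype.card_fin, nsmul_eq_mul]
    linarith
  · simp_rw [mul_sub, Finset.sum_sub_distrib, ← Finset.sum_mul]
    rw [hI, hp.2]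
    ring

end Information

section Block

variable {n : ℕ}

/-- The kernels from which the codewords of block length `n` are drawn. -/
def blockKernel (p : ((i : Fin r) → 𝓕 i) × 𝒱 × 𝒳 → ℝ) (x : Fin n → 𝒳) :
    LevelKernel (fun i : Fin r => Fin n → 𝓕 i) :=
  fun s g a => ∏ k, kernelF p s (fun j => g j k) (x k) (a k)

lemma blockKernel_isMarkov (hp : ∀ a, 0 ≤ p a) [∀ i, Nonempty (𝓕 i)] (x : Fin n → 𝒳) :
    (blockKernel p x).IsMarkov := fun s g =>
  ⟨fun _ => Finset.prod_nonneg fun _ _ => kernelF_nonneg hp _ _ _ _,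
    sum_prod_eq_one (fun k => kernelF p s (fun j => g j k) (x k)) fun _ => sum_kernelF _ _ _⟩

lemma probCb_nonneg (hp : ∀ a, 0 ≤ p a) (R' : Fin r → ℝ) (x : Fin n → 𝒳) (D : Cb 𝓕 R' n) :
    0 ≤ probCb p R' n x D :=
  Finset.prod_nonneg fun _ _ => Finset.prod_nonneg fun _ _ => Finset.prod_nonneg fun _ _ =>
    condF_nonneg hp _ _ _ _

lemma probCb_le_codebookProb (hp : ∀ a, 0 ≤ p a) (R' : Fin r → ℝ) (x : Fin n → 𝒳)
    (D : Cb 𝓕 R' n) : probCb p R' n x D ≤ codebookProb (Ncw R' n) (blockKernel p x) D :=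
  Finset.prod_le_prod
    (fun _ _ => Finset.prod_nonneg fun _ _ => Finset.prod_nonneg fun _ _ => condF_nonneg hp _ _ _ _)
    fun _ _ => Finset.prod_le_prod
      (fun _ _ => Finset.prod_nonneg fun _ _ => condF_nonneg hp _ _ _ _)
      fun _ _ => Finset.prod_le_prod (fun _ _ => condF_nonneg hp _ _ _ _)
        fun _ _ => condF_le_kernelF _ _ _ _

lemma prod_pXm_mul_chainProb (hp : ∀ a, 0 ≤ p a) (x : Fin n → 𝒳)
    (f : (i : Fin r) → Fin n → 𝓕 i) :
    (∏ k, pXm p (x k)) * chainProb (blockKernel p x) f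
      = ∏ k, ∑ v, p (fun i => f i k, v, x k) := by
  simp only [chainProb, blockKernel]
  rw [Finset.prod_comm, ← Finset.prod_mul_distrib]
  exact Finset.prod_congr rfl fun k _ => pXm_mul_prod_kernelF hp (fun i => f i k) (x k)

lemma sum_ite_prefix_prod (m : ℕ) (φ : Fin n → ((i : Fin r) → 𝓕 i) → ℝ)
    (f₀ : (i : Fin r) → Fin n → 𝓕 i) :
    (∑ f : (i : Fin r) → Fin n → 𝓕 i,
      if ∀ i : Fin r, (i : ℕ) < m → f i = f₀ i then ∏ k, φ k (fun i => f i k) else 0)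
    = ∏ k, ∑ g : (i : Fin r) → 𝓕 i,
        if ∀ i : Fin r, (i : ℕ) < m → g i = f₀ i k then φ k g else 0 := by
  rw [Fintype.prod_sum, ← (Equiv.piComm fun (_ : Fin n) (i : Fin r) => 𝓕 i).sum_comp]
  refine Finset.sum_congr rfl fun g _ => ?_
  rw [Finset.prod_ite_zero]
  congr 1
  simp only [Equiv.piComm_apply, funext_iff, Finset.mem_univ, true_imp_iff, eq_iff_iff]
  exact ⟨fun h k i hi => h i hi k, fun h i hi k => h k i hi⟩

omit [Fintype 𝒱] [∀ i, DecidableEq (𝓕 i)] in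
lemma sum_prod_eq_prod_pVXm (v : Fin n → 𝒱) (x : Fin n → 𝒳) :
    ∑ f : (i : Fin r) → Fin n → 𝓕 i, ∏ k, p (fun i => f i k, v k, x k)
      = ∏ k, pVXm p (v k) (x k) := by
  rw [← (Equiv.piComm fun (_ : Fin n) (i : Fin r) => 𝓕 i).sum_comp]
  simp only [pVXm, Fintype.prod_sum]
  rfl

/-- The probability of `v` along one branch of the codebook. -/
def blockChannel (p : ((i : Fin r) → 𝓕 i) × 𝒱 × 𝒳 → ℝ) (x : Fin n → 𝒳) (v : Fin n → 𝒱)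
    (f : (i : Fin r) → Fin n → 𝓕 i) : ℝ :=
  ∏ k, condVF p (fun i => f i k) (x k) (v k)

lemma prod_pXm_mul_chainProb_mul_blockChannel (hp : ∀ a, 0 ≤ p a) (x : Fin n → 𝒳)
    (v : Fin n → 𝒱) (f : (i : Fin r) → Fin n → 𝓕 i) :
    (∏ k, pXm p (x k)) * (chainProb (blockKernel p x) f * blockChannel p x v f)
      = ∏ k, p (fun i => f i k, v k, x k) := by
  rw [← mul_assoc, prod_pXm_mul_chainProb hp, blockChannel, ← Finset.prod_mul_distrib]
  exact Finset.prod_congr rfl fun k _ => sum_mul_condVF hp _ _ _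

lemma Ncw_pos (R' : Fin r → ℝ) (n : ℕ) (i : Fin r) : 0 < Ncw R' n i :=
  Nat.ceil_pos.2 (by positivity)

open Classical in
/-- The expected distance between `Q(v|x) p(x)` and `p(v,x)` at one pair of blocks. -/
lemma sum_codebookProb_mul_abs_Qdist_sub_le (hp : ∀ a, 0 ≤ p a) [∀ i, Nonempty (𝓕 i)]
    (R' : Fin r → ℝ) {c : Fin r → ℝ} (hc : ∀ s, 0 ≤ c s) (v : Fin n → 𝒱) (x : Fin n → 𝒳) :
    ∑ D : Cb 𝓕 R' n, codebookProb (Ncw R' n) (blockKernel p x) D *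
        |Qdist p R' n D x v * ∏ k, pXm p (x k) - ∏ k, pVXm p (v k) (x k)|
      ≤ (∏ k, pVXm p (v k) (x k))
          * √(∑ s, (∏ i ∈ Finset.univ.filter (· ≤ s), (Ncw R' n i : ℝ))⁻¹ * c s)
        + 2 * ∑ f : (i : Fin r) → Fin n → 𝓕 i,
          if RatioBounded p c (fun k => (fun i => f i k, v k, x k)) then 0
          else ∏ k, p (fun i => f i k, v k, x k) := by
  have hX0 : 0 ≤ ∏ k, pXm p (x k) := Finset.prod_nonneg fun k _ =>
    Finset.sum_nonneg fun f _ => Finset.sum_nonneg fun v _ => hp _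
  set h : ((i : Fin r) → Fin n → 𝓕 i) → ℝ := fun f =>
    if RatioBounded p c (fun k => (fun i => f i k, v k, x k)) then blockChannel p x v f else 0
    with hh
  have hg0 (f) : 0 ≤ blockChannel p x v f := Finset.prod_nonneg fun k _ =>
    div_nonneg (hp _) (Finset.sum_nonneg fun v _ => hp _)
  obtain ⟨P, hPdef⟩ : ∃ P, P = ∑ f, chainProb (blockKernel p x) f * blockChannel p x v f :=
    ⟨_, rfl⟩
  have hP0 : 0 ≤ P := hPdef ▸ Finset.sum_nonneg fun f _ =>
    mul_nonneg (chainProb_nonneg (blockKernel_isMarkov hp x) f) (hg0 f)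
  have hP : (∏ k, pXm p (x k)) * P = ∏ k, pVXm p (v k) (x k) := by
    simp_rw [hPdef, Finset.mul_sum, prod_pXm_mul_chainProb_mul_blockChannel hp,
      sum_prod_eq_prod_pVXm]
  rcases hX0.eq_or_lt with hz | hXpos
  · rw [← hP, ← hz]
    simp only [mul_zero, zero_mul, sub_zero, abs_zero, Finset.sum_const_zero, zero_add]
    refine mul_nonneg zero_le_two (Finset.sum_nonneg fun f _ => ?_)
    split_ifs
    exacts [le_rfl, Finset.prod_nonneg fun k _ => hp _]
  have hC : ∀ s (f₀ : (i : Fin r) → Fin n → 𝓕 i),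
      (∑ f, if ∀ i ≤ s, f i = f₀ i then chainProb (blockKernel p x) f * h f else 0)
        ≤ c s * P * ∑ f, if ∀ i ≤ s, f i = f₀ i then chainProb (blockKernel p x) f else 0 := by
    intro s f₀
    have hle (f : (i : Fin r) → Fin n → 𝓕 i) :
        (∀ i ≤ s, f i = f₀ i) ↔ ∀ i : Fin r, (i : ℕ) < s + 1 → f i = f₀ i :=
      forall_congr' fun i => by rw [Nat.lt_succ_iff, Fin.le_iff_val_le_val]
    simp only [hle]
    set J := ∑ f : (i : Fin r) → Fin n → 𝓕 i,
      if ∀ i : Fin r, (i : ℕ) < s + 1 → f i = f₀ i then chainProb (blockKernel p x) f else 0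
      with hJ
    have hXJ : (∏ k, pXm p (x k)) * J
        = ∏ k, marginalFX p (s + 1) (fun i => f₀ i k) (x k) := by
      simp_rw [hJ, Finset.mul_sum, mul_ite, mul_zero, prod_pXm_mul_chainProb hp]
      exact sum_ite_prefix_prod (s + 1) (fun k g => ∑ v, p (g, v, x k)) f₀
    have hW : (∏ k, pXm p (x k)) * (∑ f : (i : Fin r) → Fin n → 𝓕 i,
          if ∀ i : Fin r, (i : ℕ) < s + 1 → f i = f₀ i
          then chainProb (blockKernel p x) f * blockChannel p x v f else 0)
        = ∏ k, marginalFVX p (s + 1) (fun i => f₀ i k, v k, x k) := by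
      simp_rw [Finset.mul_sum, mul_ite, mul_zero, prod_pXm_mul_chainProb_mul_blockChannel hp]
      exact sum_ite_prefix_prod (s + 1) (fun k g => p (g, v k, x k)) f₀
    by_cases hR : ∏ k, (marginalFVX p (s + 1) (fun i => f₀ i k, v k, x k) * pXm p (x k))
        ≤ c s * ∏ k, (pVXm p (v k) (x k) * marginalFX p (s + 1) (fun i => f₀ i k) (x k))
    · rw [Finset.prod_mul_distrib, Finset.prod_mul_distrib, ← hW, ← hXJ, ← hP] at hR
      refine le_trans (b := ∑ f : (i : Fin r) → Fin n → 𝓕 i,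
          if ∀ i : Fin r, (i : ℕ) < s + 1 → f i = f₀ i
          then chainProb (blockKernel p x) f * blockChannel p x v f else 0)
        (Finset.sum_le_sum fun f _ => ?_)
        (le_of_mul_le_mul_left (a := (∏ k, pXm p (x k)) * ∏ k, pXm p (x k)) ?_ (by positivity))
      · split_ifs
        · refine mul_le_mul_of_nonneg_left ?_ (chainProb_nonneg (blockKernel_isMarkov hp x) f)
          simp only [hh]
          split_ifs
          exacts [le_rfl, hg0 f]
        · exact le_rfl
      · linarith
    · have hzero : (∑ f : (i : Fin r) → Fin n → 𝓕 i,
          if ∀ i : Fin r, (i : ℕ) < s + 1 → f i = f₀ i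
          then chainProb (blockKernel p x) f * h f else 0) = 0 := by
        refine Finset.sum_eq_zero fun f _ => ?_
        split_ifs with hf
        · have : ¬ RatioBounded p c (fun k => (fun i => f i k, v k, x k)) := by
            intro hb
            apply hR
            simpa only [marginalFVX_congr fun i hi => congrFun (hf i hi) _,
              marginalFX_congr fun i hi => congrFun (hf i hi) _] using hb s
          simp [hh, this]
        · rfl
      rw [hzero]
      have hJ0 : 0 ≤ J := Finset.sum_nonneg fun f _ => by
        split_ifs
        exacts [chainProb_nonneg (blockKernel_isMarkov hp x) f, le_rfl]
      exact mul_nonneg (mul_nonneg (hc s) hP0) hJ0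
  have main := sum_codebookProb_mul_abs_mean_sub_le (Ncw_pos R' n) (blockKernel_isMarkov hp x)
    (g := blockChannel p x v) (h := h)
    (fun f => by simp only [hh]; split_ifs; exacts [hg0 f, le_rfl])
    (fun f => by simp only [hh]; split_ifs; exacts [le_rfl, hg0 f]) hc
    (by simpa only [← hPdef] using hC)
  rw [← hPdef] at main
  have htail : ∑ f : (i : Fin r) → Fin n → 𝓕 i,
      (if RatioBounded p c (fun k => (fun i => f i k, v k, x k)) then 0
        else ∏ k, p (fun i => f i k, v k, x k))
      = (∏ k, pXm p (x k)) *
        ∑ f, chainProb (blockKernel p x) f * (blockChannel p x v f - h f) := by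
    rw [Finset.mul_sum]
    refine Finset.sum_congr rfl fun f _ => ?_
    simp only [hh]
    split_ifs
    · simp
    · rw [sub_zero, prod_pXm_mul_chainProb_mul_blockChannel hp]
  rw [htail, ← hP]
  refine le_trans (le_of_eq ?_) ((mul_le_mul_of_nonneg_left main hX0).trans (le_of_eq ?_))
  · rw [Finset.mul_sum]
    refine Finset.sum_congr rfl fun D _ => ?_
    have hQ : Qdist p R' n D x v
        = Codebook.mean (A := fun i => Fin n → 𝓕 i) (N := Ncw R' n) D (blockChannel p x v) := rfl
    rw [hQ, mul_comm _ (∏ k, pXm p (x k)), ← mul_sub, abs_mul, abs_of_nonneg hX0]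
    ring
  · ring

omit [∀ i, DecidableEq (𝓕 i)] in
lemma sum_blocks_eq_sum [Fintype 𝒳]
    (φ : (Fin n → ((i : Fin r) → 𝓕 i) × 𝒱 × 𝒳) → ℝ) :
    ∑ a : (Fin n → 𝒱) × (Fin n → 𝒳), ∑ f : (i : Fin r) → Fin n → 𝓕 i,
        φ (fun k => (fun i => f i k, a.1 k, a.2 k))
      = ∑ ω, φ ω := by
  rw [← Fintype.sum_prod_type_right', ← Equiv.sum_comp
    ((Equiv.prodCongr (Equiv.piComm fun (_ : Fin n) (i : Fin r) => 𝓕 i).symm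
      (Equiv.arrowProdEquivProdArrow (Fin n) (fun _ => 𝒱) fun _ => 𝒳).symm).trans
      (Equiv.arrowProdEquivProdArrow (Fin n) (fun _ => (i : Fin r) → 𝓕 i)
        fun _ => 𝒱 × 𝒳).symm)]
  rfl

omit [∀ i, DecidableEq (𝓕 i)] in
lemma sum_prod_pVXm [Fintype 𝒳] (hp : IsPMF p) :
    ∑ a : (Fin n → 𝒱) × (Fin n → 𝒳), ∏ k, pVXm p (a.1 k) (a.2 k) = 1 := by
  simp_rw [← sum_prod_eq_prod_pVXm]
  rw [sum_blocks_eq_sum fun ω => ∏ k, p (ω k)]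
  exact sum_prod_eq_one (fun _ => p) fun _ => hp.2

open Classical in
/-- The expected distance between the induced and the i.i.d. distribution is at most a
covering term plus twice the probability that some likelihood ratio exceeds its bound. -/
lemma sum_prod_probCb_mul_l1dist_le [Fintype 𝒳] [DecidableEq 𝒳] (hp : IsPMF p)
    [∀ i, Nonempty (𝓕 i)] (R' : Fin r → ℝ) {c : Fin r → ℝ} (hc : ∀ s, 0 ≤ c s) :
    ∑ G : (Fin n → 𝒳) → Cb 𝓕 R' n, (∏ x : Fin n → 𝒳, probCb p R' n x (G x)) *
        l1dist
          (fun a : (Fin n → 𝒱) × (Fin n → 𝒳) =>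
            Qdist p R' n (G a.2) a.2 a.1 * ∏ k, pXm p (a.2 k))
          (fun a : (Fin n → 𝒱) × (Fin n → 𝒳) => ∏ k, pVXm p (a.1 k) (a.2 k))
      ≤ √(∑ s, (∏ i ∈ Finset.univ.filter (· ≤ s), (Ncw R' n i : ℝ))⁻¹ * c s)
        + 2 * ∑ ω : Fin n → ((i : Fin r) → 𝓕 i) × 𝒱 × 𝒳,
          if RatioBounded p c ω then 0 else ∏ k, p (ω k) := by
  refine (Finset.sum_le_sum fun G _ => mul_le_mul_of_nonneg_right
    (Finset.prod_le_prod (fun x _ => probCb_nonneg hp.1 R' x (G x))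
      fun x _ => probCb_le_codebookProb hp.1 R' x (G x))
    (Finset.sum_nonneg fun _ _ => abs_nonneg _)).trans ?_
  simp only [Finset.mul_sum]
  rw [Finset.sum_comm]
  have hG (a : (Fin n → 𝒱) × (Fin n → 𝒳)) :=
    (sum_prod_mul_apply (fun x D => codebookProb (Ncw R' n) (blockKernel p x) D)
      (fun x => sum_codebookProb (Ncw R' n) (blockKernel_isMarkov hp.1 x)) a.2
      fun D : Cb 𝓕 R' n => |Qdist p R' n D a.2 a.1 * ∏ k, pXm p (a.2 k)
        - ∏ k, pVXm p (a.1 k) (a.2 k)|).trans_le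
      (sum_codebookProb_mul_abs_Qdist_sub_le hp.1 R' hc a.1 a.2)
  refine (Finset.sum_le_sum fun a _ => hG a).trans (le_of_eq ?_)
  rw [Finset.sum_add_distrib, ← Finset.sum_mul, sum_prod_pVXm hp, one_mul, ← Finset.mul_sum,
    ← Finset.mul_sum,
    sum_blocks_eq_sum fun ω => if RatioBounded p c ω then 0 else ∏ k, p (ω k)]

lemma inv_prod_Ncw_mul_le (R' : Fin r → ℝ) (n : ℕ) (T : Finset (Fin r)) (b : ℝ) :
    (∏ i ∈ T, (Ncw R' n i : ℝ))⁻¹ * 2 ^ (n * b) ≤ (2 ^ (b - ∑ i ∈ T, R' i) : ℝ) ^ n := by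
  have h : (2 : ℝ) ^ (n * ∑ i ∈ T, R' i) ≤ ∏ i ∈ T, (Ncw R' n i : ℝ) := by
    rw [Finset.mul_sum, Real.rpow_sum_of_pos two_pos]
    exact Finset.prod_le_prod (fun i _ => by positivity) fun i _ => Nat.le_ceil _
  calc (∏ i ∈ T, (Ncw R' n i : ℝ))⁻¹ * 2 ^ (n * b)
      ≤ (2 ^ (n * ∑ i ∈ T, R' i))⁻¹ * 2 ^ (n * b) := by gcongr
    _ = (2 ^ (b - ∑ i ∈ T, R' i) : ℝ) ^ n := by
      rw [← Real.rpow_neg two_pos.le, ← Real.rpow_add two_pos, ← Real.rpow_mul_natCast two_pos.le]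
      congr 1
      ring

end Block

end SingleLetter

/-- generalized soft-covering lemma. Fix a pmf `p(f₁,…,f_r, v, x)` and
positive reals `R'₁, …, R'_r` with `Σ_{i=1}^s R'_i > I(V; F₁,…,F_s | X)` for every `s`.
Draw, independently for each source sequence `x_{1:n}`, a random superposition codebook
`G x` as described in `probCb`. Then the expected ℓ¹ distance between the induced joint
distribution `Q(v_{1:n} | x_{1:n}) Π_k p_X(x_k)` and the i.i.d. product
`Π_k p_{V,X}(v_k, x_k)` tends to `0` as `n → ∞`.
Coordinates on the sample space of `p`: `a.1 = f`, `a.2.1 = v`, `a.2.2 = x`. -/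
theorem generalized_soft_covering
    {𝒱 𝒳 : Type} [Fintype 𝒱] [DecidableEq 𝒱] [Fintype 𝒳] [DecidableEq 𝒳]
    {r : ℕ} {𝓕 : Fin r → Type} [∀ i, Fintype (𝓕 i)] [∀ i, DecidableEq (𝓕 i)]
    (p : ((i : Fin r) → 𝓕 i) × 𝒱 × 𝒳 → ℝ) (hp : IsPMF p)
    (R' : Fin r → ℝ) (hpos : ∀ i, 0 < R' i)
    -- Σ_{i=1}^s R'_i > I(V; F₁,…,F_s | X) for every 1 ≤ s ≤ r
    (hrate : ∀ s : Fin r,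
      (∑ i ∈ Finset.univ.filter (fun i : Fin r => i ≤ s), R' i) >
        cmi p (fun a => a.2.1)
          (fun a => (fun j : Fin ((s : ℕ) + 1) => a.1 ⟨j.1, lt_of_lt_of_le j.2 s.2⟩))
          (fun a => a.2.2)) :
    Filter.Tendsto (fun n : ℕ =>
      ∑ G : (Fin n → 𝒳) → Cb 𝓕 R' n,
        (∏ x : Fin n → 𝒳, probCb p R' n x (G x)) *
          l1dist
            (fun a : (Fin n → 𝒱) × (Fin n → 𝒳) =>
              Qdist p R' n (G a.2) a.2 a.1 * ∏ k, pXm p (a.2 k))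
            (fun a : (Fin n → 𝒱) × (Fin n → 𝒳) => ∏ k, pVXm p (a.1 k) (a.2 k)))
      Filter.atTop (nhds 0) := by
  have hne : ∀ i, Nonempty (𝓕 i) := by
    by_contra! h
    obtain ⟨i, hi⟩ := h
    have : IsEmpty (((i : Fin r) → 𝓕 i) × 𝒱 × 𝒳) := ⟨fun a => hi.false (a.1 i)⟩
    simpa using hp.2
  obtain ⟨I, hI⟩ : ∃ I : Fin r → ℝ, ∀ s : Fin r, ∑ a, p a * infoDensity p (s + 1) a = I s :=
    ⟨_, fun _ => rfl⟩
  simp only [cmi_eq_sum_mul_infoDensity hp.1, hI] at hrate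
  let R : Fin r → ℝ := fun s => ∑ i ∈ Finset.univ.filter (· ≤ s), R' i
  let δ : Fin r → ℝ := fun s => (R s - I s) / 2
  have hδ : ∀ s, 0 < δ s := fun s => half_pos (sub_pos.2 (hrate s))
  let B : ℝ := ∑ s : Fin r, (∑ a, p a * (infoDensity p (s + 1) a - I s) ^ 2) / δ s ^ 2
  have hlim : Filter.Tendsto
      (fun n : ℕ => √(∑ s, (2 ^ (I s + δ s - R s) : ℝ) ^ n) + 2 * (B * (n : ℝ)⁻¹))
      Filter.atTop (nhds 0) := by
    have hneg (s : Fin r) : I s + δ s - R s < 0 := by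
      linarith [hδ s, show δ s = (R s - I s) / 2 from rfl]
    have hpow (s : Fin r) : Filter.Tendsto (fun n : ℕ => (2 ^ (I s + δ s - R s) : ℝ) ^ n)
        Filter.atTop (nhds 0) :=
      tendsto_pow_atTop_nhds_zero_of_lt_one (by positivity)
        (Real.rpow_lt_one_of_one_lt_of_neg one_lt_two (hneg s))
    simpa using (tendsto_finsetSum Finset.univ fun s _ => hpow s).sqrt.add
      ((tendsto_inv_atTop_nhds_zero_nat (𝕜 := ℝ)).const_mul B |>.const_mul 2)
  refine squeeze_zero' (Filter.Eventually.of_forall fun n => Finset.sum_nonneg fun G _ =>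
    mul_nonneg (Finset.prod_nonneg fun x _ => probCb_nonneg hp.1 R' x (G x))
      (Finset.sum_nonneg fun _ _ => abs_nonneg _)) ?_ hlim
  filter_upwards [Filter.eventually_gt_atTop 0] with n hn
  refine (sum_prod_probCb_mul_l1dist_le hp R' (c := fun s => 2 ^ (n * (I s + δ s)))
    fun s => by positivity).trans (add_le_add (Real.sqrt_le_sqrt (Finset.sum_le_sum fun s _ =>
      inv_prod_Ncw_mul_le R' n _ _)) ?_)
  exact mul_le_mul_of_nonneg_left (sum_ite_not_ratioBounded_le hp hI hδ hn) zero_le_two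

end Coord
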